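/- Let T⃗ = (T_1,…,T_d) be a vector homogeneous tree, W a homogeneous tree with branching number b_W, 0 < ε ≤ 1 and D : ⊗T⃗ → 2^W an ε-dense level selection. Set Θ_n = |fan(T⃗,n)| and θ_n = ε/(2 b_W Θ_n) for n ≥ 1. Assume hypothesis (H): for every vector strong subtree R⃗ of T⃗, every w ∈ W and every 0 < θ ≤ 1, the pair (R⃗, w) is not strongly θ-correlated with respect to D. Then there exists a vector strong subtree S⃗ of T⃗ with the following property: for every s⃗_0 ∈ ⊗S⃗ there exists a map φ_{s⃗_0} : D(s⃗_0) → {0,…,b_W−1} such that for every n > ℓ_{S⃗}(s⃗_0) (where ℓ_{S⃗}(s⃗_0) is the unique level of s⃗_0 in ⊗S⃗), every vector fan F⃗ ∈ fan(S⃗,n) with F⃗(0) = s⃗_0 and every w ∈ D(s⃗_0), dens(⋂_{s⃗ ∈ ⊗F⃗(1)} D(s⃗) | w⌢_W φ_{s⃗_0}(w)) ≤ θ_n. -/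

import Mathlib

open Filter

namespace DHLPaper

/-- The tree `b^{<ℕ}` of all finite sequences with values in `{0,…,b−1}`,
partially ordered by end-extension (`List.IsPrefix`, written `<+:`). -/
def bSeq (b : ℕ) : Set (List ℕ) := {t | ∀ x ∈ t, x < b}

/-- The set of successors of `t` in `T`: `Suc_T(t) = {s ∈ T : t ≤ s}`. -/
def suc (T : Set (List ℕ)) (t : List ℕ) : Set (List ℕ) := {s ∈ T | t <+: s}

/-- `s` is an immediate successor of `t` in `T`. -/
def ImmSuc (T : Set (List ℕ)) (t s : List ℕ) : Prop :=
  t ∈ T ∧ s ∈ T ∧ t <+: s ∧ t ≠ s ∧ ∀ u ∈ T, t <+: u → u <+: s → u = t ∨ u = s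

/-- The `n`-th level of `T`: the nodes of `T` with exactly `n` strict predecessors in `T`. -/
def level (T : Set (List ℕ)) (n : ℕ) : Set (List ℕ) :=
  {t ∈ T | {s ∈ T | s <+: t ∧ s ≠ t}.ncard = n}

/-- `T` has exactly one minimal node. -/
def UniquelyRooted (T : Set (List ℕ)) : Prop := ∃! r, r ∈ level T 0

/-- Every node of `T` has finitely many immediate successors in `T`. -/
def FinitelyBranching (T : Set (List ℕ)) : Prop := ∀ t ∈ T, {s | ImmSuc T t s}.Finite

/-- Every node of `T` has at least one immediate successor in `T`. -/
def Pruned (T : Set (List ℕ)) : Prop := ∀ t ∈ T, ∃ s, ImmSuc T t s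

/-- `S` is a strong subtree of `T` whose level set `L_T(S)` is enumerated by the strictly
increasing map `l`: `S(n) ⊆ T(l n)` for every `n`, `S` is uniquely rooted, and for every
`s ∈ S` and every immediate successor `t` of `s` in `T` there is a unique immediate
successor `s'` of `s` in `S` with `t ≤ s'`. -/
def IsStrongSubtreeWith (T S : Set (List ℕ)) (l : ℕ → ℕ) : Prop :=
  S ⊆ T ∧ UniquelyRooted S ∧ StrictMono l ∧
    (∀ n, level S n ⊆ level T (l n)) ∧
    (∀ s ∈ S, ∀ t, ImmSuc T s t → ∃! s', ImmSuc S s s' ∧ t <+: s')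

/-- `S` is a strong subtree of `T`. -/
def IsStrongSubtree (T S : Set (List ℕ)) : Prop := ∃ l, IsStrongSubtreeWith T S l

/-- A homogeneous tree with branching number `b`: a strong subtree of `b^{<ℕ}`, `b ≥ 2`. -/
def IsHomogeneous (b : ℕ) (T : Set (List ℕ)) : Prop := 2 ≤ b ∧ IsStrongSubtree (bSeq b) T

/-- A vector homogeneous tree: a `d`-tuple of homogeneous trees. -/
def IsVecHomogeneous {d : ℕ} (b : Fin d → ℕ) (T : Fin d → Set (List ℕ)) : Prop :=
  ∀ i, IsHomogeneous (b i) (T i)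

/-- Vector strong subtree: componentwise strong subtrees with a common level set. -/
def IsVecStrongSubtree {d : ℕ} (T S : Fin d → Set (List ℕ)) : Prop :=
  ∃ l, ∀ i, IsStrongSubtreeWith (T i) (S i) l

/-- `⊗T(n) = T_1(n) × ⋯ × T_d(n)`. -/
def vecLevel {d : ℕ} (T : Fin d → Set (List ℕ)) (n : ℕ) : Set (Fin d → List ℕ) :=
  {v | ∀ i, v i ∈ level (T i) n}

/-- The level product `⊗T = ⋃_n ⊗T(n)`. -/
def levelProd {d : ℕ} (T : Fin d → Set (List ℕ)) : Set (Fin d → List ℕ) :=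
  ⋃ n, vecLevel T n

/-- `r` is the root tuple of the vector tree `T`. -/
def IsRoot {d : ℕ} (T : Fin d → Set (List ℕ)) (r : Fin d → List ℕ) : Prop :=
  ∀ i, level (T i) 0 = {r i}

/-- `F` is a vector fan of `T`: `F = (R_1(0) ∪ R_1(1), …, R_d(0) ∪ R_d(1))` for some
vector strong subtree `R` of `T`. -/
def IsVecFan {d : ℕ} (T F : Fin d → Set (List ℕ)) : Prop :=
  ∃ R : Fin d → Set (List ℕ), IsVecStrongSubtree T R ∧
    ∀ i, F i = level (R i) 0 ∪ level (R i) 1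

/-- `fan(T,n)`: the vector fans of `T` with `⊗F(1) ⊆ ⊗T(n)`. -/
def fanAt {d : ℕ} (T : Fin d → Set (List ℕ)) (n : ℕ) : Set (Fin d → Set (List ℕ)) :=
  {F | IsVecFan T F ∧ vecLevel F 1 ⊆ vecLevel T n}

/-- Density of `F ⊆ W(n)` in the `n`-th level of `W`. -/
noncomputable def dens (W : Set (List ℕ)) (n : ℕ) (F : Set (List ℕ)) : ℝ :=
  (F.ncard : ℝ) / ((level W n).ncard : ℝ)

/-- Density of `F ⊆ W(n)` relative to the node `w`. -/
noncomputable def densRel (W : Set (List ℕ)) (n : ℕ) (F : Set (List ℕ)) (w : List ℕ) : ℝ :=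
  ((F ∩ suc W w).ncard : ℝ) / ((level W n ∩ suc W w).ncard : ℝ)

/-- `s = w ⌢_W p`: `s` is the immediate successor of `w` in `W` such that the
concatenation `w ⌢ p` is an initial segment of `s`. -/
def IsConcat (W : Set (List ℕ)) (w : List ℕ) (p : ℕ) (s : List ℕ) : Prop :=
  ImmSuc W w s ∧ w ++ [p] <+: s

/-- The density Halpern–Läuchli statement in dimension `d`. -/
def DHL (d : ℕ) : Prop :=
  ∀ (b : Fin d → ℕ) (T : Fin d → Set (List ℕ)), IsVecHomogeneous b T →
    ∀ D : Set (Fin d → List ℕ), D ⊆ levelProd T →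
      0 < Filter.limsup
          (fun n => ((D ∩ vecLevel T n).ncard : ℝ) / ((vecLevel T n).ncard : ℝ)) atTop →
      ∃ S : Fin d → Set (List ℕ), IsVecStrongSubtree T S ∧ levelProd S ⊆ D

/-- `D : ⊗T → 2^W` is an `ε`-dense level selection along the strictly increasing
sequence `l`: for every `n` and every `t⃗ ∈ ⊗T(n)`, `D(t⃗) ⊆ W(l n)` and
`dens(D(t⃗)) ≥ ε`. -/
def IsDenseLevelSel {d : ℕ} (T : Fin d → Set (List ℕ)) (W : Set (List ℕ)) (l : ℕ → ℕ)
    (ε : ℝ) (D : (Fin d → List ℕ) → Set (List ℕ)) : Prop :=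
  StrictMono l ∧ ∀ n, ∀ v ∈ vecLevel T n, D v ⊆ level W (l n) ∧ ε ≤ dens W (l n) (D v)

/-- The pair `(R, w)` (`R` a vector strong subtree of `T` with root tuple `r0`) is strongly
`θ`-correlated with respect to the dense level selection `D` (with level sequence `l`):
`w ∈ D(r0)` and for every vector fan `F` of `R` with `F(0) = r0` and every `p < b_W`,
`dens(⋂_{r ∈ ⊗F(1)} D(r) | w ⌢_W p) ≥ θ`. -/
def StronglyCorrelated {d : ℕ} (T : Fin d → Set (List ℕ)) (W : Set (List ℕ)) (bW : ℕ)
    (l : ℕ → ℕ) (D : (Fin d → List ℕ) → Set (List ℕ)) (R : Fin d → Set (List ℕ))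
    (r0 : Fin d → List ℕ) (w : List ℕ) (θ : ℝ) : Prop :=
  w ∈ D r0 ∧
    ∀ F : Fin d → Set (List ℕ), IsVecFan R F → IsRoot F r0 →
      ∀ n, vecLevel F 1 ⊆ vecLevel T n →
        ∀ p < bW, ∀ s, IsConcat W w p s →
          θ ≤ densRel W (l n) (⋂ r ∈ vecLevel F 1, D r) s

section Ultrafilters

attribute [local instance] Ultrafilter.mul Ultrafilter.semigroup

/-- `L` is a minimal left ideal of the semigroup of ultrafilters on `M`, and is closed. -/
structure IsMinLeftIdeal {M : Type*} [Semigroup M] (L : Set (Ultrafilter M)) : Prop where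
  isClosed : IsClosed L
  nonempty : L.Nonempty
  mul_mem : ∀ r, ∀ a ∈ L, r * a ∈ L
  exists_mul_eq : ∀ a ∈ L, ∀ e ∈ L, ∃ r, r * e = a

theorem IsMinLeftIdeal.mul_idem {M : Type*} [Semigroup M] {L : Set (Ultrafilter M)}
    (hL : IsMinLeftIdeal L) {a e : Ultrafilter M} (ha : a ∈ L) (he : e ∈ L) (hee : e * e = e) :
    a * e = a := by
  obtain ⟨r, rfl⟩ := hL.exists_mul_eq a ha e he
  rw [mul_assoc, hee]

theorem exists_isMinLeftIdeal_subset {M : Type*} [Semigroup M] (e : Ultrafilter M) :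
    ∃ L : Set (Ultrafilter M), IsMinLeftIdeal L ∧ ∀ a ∈ L, ∃ r, r * e = a := by
  have closed_range : ∀ x : Ultrafilter M, IsClosed (Set.range (· * x)) := fun x =>
    (isCompact_range (Ultrafilter.continuous_mul_left x)).isClosed
  let S : Set (Set (Ultrafilter M)) :=
    {N | IsClosed N ∧ N.Nonempty ∧ ∀ r, ∀ a ∈ N, r * a ∈ N}
  have range_mem : ∀ x : Ultrafilter M, Set.range (· * x) ∈ S := fun x =>
    ⟨closed_range x, ⟨x * x, x, rfl⟩, by
      rintro r _ ⟨a, rfl⟩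
      exact ⟨r * a, mul_assoc _ _ _⟩⟩
  obtain ⟨L, hLe, hL⟩ := zorn_superset_nonempty S (by
    intro c hcS hc hne
    refine ⟨⋂₀ c, ⟨isClosed_sInter fun t ht => (hcS ht).1, ?_, ?_⟩,
      fun s hs => Set.sInter_subset_of_mem hs⟩
    · have : Nonempty c := hne.to_subtype
      exact IsCompact.nonempty_sInter_of_directed_nonempty_isCompact_isClosed
        (fun x hx y hy => (hc.total hx hy).elim (fun h => ⟨x, hx, subset_rfl, h⟩)
          fun h => ⟨y, hy, h, subset_rfl⟩) (fun U hU => (hcS hU).2.1)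
        (fun U hU => (hcS hU).1.isCompact) fun U hU => (hcS hU).1
    · intro r a ha t ht
      exact (hcS ht).2.2 r a (ha t ht)) _ (range_mem e)
  refine ⟨L, ⟨hL.prop.1, hL.prop.2.1, hL.prop.2.2, ?_⟩, fun a ha => hLe ha⟩
  intro a ha x hx
  have hsub : Set.range (· * x) ⊆ L := by
    rintro _ ⟨r, rfl⟩
    exact hL.prop.2.2 r x hx
  exact hL.le_of_le (range_mem x) hsub ha

theorem IsMinLeftIdeal.exists_idem {M : Type*} [Semigroup M] {L : Set (Ultrafilter M)}
    (hL : IsMinLeftIdeal L) (G : Set M) (hG : ∀ g ∈ G, ∀ m, g * m ∈ G) (hne : G.Nonempty) :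
    ∃ q ∈ L, q * q = q ∧ ∀ᶠ m in q, m ∈ G := by
  obtain ⟨g, hg⟩ := hne
  obtain ⟨a, ha⟩ := hL.nonempty
  obtain ⟨q, ⟨hqL, hqG⟩, hq⟩ := exists_idempotent_in_compact_subsemigroup
    Ultrafilter.continuous_mul_left (L ∩ {u | G ∈ u})
    ⟨pure g * a, hL.mul_mem _ _ ha, by
      change ∀ᶠ m in ((pure g * a : Ultrafilter M) : Filter M), m ∈ G
      rw [Ultrafilter.eventually_mul, Ultrafilter.coe_pure, eventually_pure]
      exact Eventually.of_forall fun m => hG g hg m⟩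
    (hL.isClosed.inter (ultrafilter_isClosed_basic G)).isCompact
    (by
      rintro x ⟨hx, hxG⟩ y ⟨hy, -⟩
      refine ⟨hL.mul_mem _ _ hy, ?_⟩
      change ∀ᶠ m in ((x * y : Ultrafilter M) : Filter M), m ∈ G
      rw [Ultrafilter.eventually_mul]
      have hx' : ∀ᶠ m in (x : Filter M), m ∈ G := hxG
      exact hx'.mono fun m hm => Eventually.of_forall fun m' => hG m hm m')
  exact ⟨q, hqL, hq, hqG⟩

theorem ultrafilter_map_mul {M N : Type*} [Mul M] [Mul N] (f : M →ₙ* N)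
    (a b : Ultrafilter M) : (a * b).map f = a.map f * b.map f := by
  refine Ultrafilter.coe_inj.mp (Filter.ext' fun p => ?_)
  simp only [Ultrafilter.eventually_mul, Ultrafilter.coe_map, eventually_map, map_mul]

theorem ultrafilter_map_surjective {M N : Type*} {f : M → N} (hf : Function.Surjective f) :
    Function.Surjective (Ultrafilter.map f) := by
  intro u
  refine ⟨u.map (Function.surjInv hf), ?_⟩
  rw [Ultrafilter.map_map]
  convert u.map_id
  exact funext fun x => Function.surjInv_eq hf x

theorem continuous_map_ultrafilter {M N : Type*} (f : M → N) :
    Continuous (Ultrafilter.map f) :=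
  ultrafilterBasis_is_basis.continuous_iff.2 <| Set.forall_mem_range.mpr fun s =>
    ultrafilter_isOpen_basic (f ⁻¹' s)

theorem IsMinLeftIdeal.map {M N : Type*} [Semigroup M] [Semigroup N] {L : Set (Ultrafilter M)}
    (hL : IsMinLeftIdeal L) (f : M →ₙ* N) (hf : Function.Surjective f) :
    IsMinLeftIdeal (Ultrafilter.map f '' L) where
  isClosed := (hL.isClosed.isCompact.image (continuous_map_ultrafilter f)).isClosed
  nonempty := hL.nonempty.image _
  mul_mem := by
    rintro r _ ⟨a, ha, rfl⟩
    obtain ⟨r, rfl⟩ := ultrafilter_map_surjective hf r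
    exact ⟨r * a, hL.mul_mem _ _ ha, ultrafilter_map_mul f r a⟩
  exists_mul_eq := by
    rintro _ ⟨a, ha, rfl⟩ _ ⟨e, he, rfl⟩
    obtain ⟨r, rfl⟩ := hL.exists_mul_eq a ha e he
    exact ⟨r.map f, (ultrafilter_map_mul f r e).symm⟩

end Ultrafilters

section Words

attribute [local instance] Ultrafilter.mul Ultrafilter.semigroup

/-- Letters assigning a value in `A i` to each word over `A i`. -/
abbrev Letter {ι : Type} (A : ι → Type) : Type := ∀ x : (Σ i, List (A i)), A x.1

/-- Letters assigning a value in `A i` to each element of `A i`. -/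
abbrev FanLetter {ι : Type} (A : ι → Type) : Type := ∀ j : (Σ i, A i), A j.1

variable {ι : Type} {A : ι → Type}

/-- The word over `A i` read off from `v` at the index `u`. -/
def readAt (v : FreeMonoid (Letter A)) (i : ι) (u : List (A i)) : List (A i) :=
  (FreeMonoid.toList v).map fun a => a ⟨i, u⟩

/-- The word over `A i` read off from `z` at the index `c`. -/
def readFan (z : FreeMonoid (FanLetter A)) (i : ι) (c : A i) : List (A i) :=
  (FreeMonoid.toList z).map fun a => a ⟨i, c⟩

/-- Restriction of words of letters along a choice `x` of indices. -/
def restr (x : ∀ i, A i → List (A i)) : FreeMonoid (Letter A) →* FreeMonoid (FanLetter A) :=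
  FreeMonoid.map fun a j => a ⟨j.1, x j.1 j.2⟩

/-- Precomposition of letters with removal of the last entry. -/
def dropHom (A : ι → Type) : FreeMonoid (Letter A) →* FreeMonoid (Letter A) :=
  FreeMonoid.map fun a x => a ⟨x.1, x.2.dropLast⟩

theorem readFan_mul (z z' : FreeMonoid (FanLetter A)) (i : ι) (c : A i) :
    readFan (z * z') i c = readFan z i c ++ readFan z' i c := by
  simp [readFan]

theorem readAt_mul (z z' : FreeMonoid (Letter A)) (i : ι) (u : List (A i)) :
    readAt (z * z') i u = readAt z i u ++ readAt z' i u := by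
  simp [readAt]

theorem readFan_one (i : ι) (c : A i) : readFan 1 i c = [] := by
  simp [readFan]

theorem readFan_restr (x : ∀ i, A i → List (A i)) (v : FreeMonoid (Letter A)) (i : ι) (c : A i) :
    readFan (restr x v) i c = readAt v i (x i c) := by
  simp [readFan, readAt, restr]

theorem length_readAt (v : FreeMonoid (Letter A)) (i : ι) (u : List (A i)) :
    (readAt v i u).length = v.length := by
  simp [readAt, FreeMonoid.length]

theorem restr_dropHom (x : ∀ i, A i → List (A i)) (v : FreeMonoid (Letter A)) :
    restr x (dropHom A v) = restr (fun i c => (x i c).dropLast) v := by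
  simp [restr, dropHom, FreeMonoid.map_map, Function.comp_def]

/-- The choice `x` consists of words of length `n` with `x i c` extending `y i` followed by `c`. -/
def IsOver (y : ∀ i, List (A i)) (x : ∀ i, A i → List (A i)) (n : ℕ) : Prop :=
  ∀ i c, y i ++ [c] <+: x i c ∧ (x i c).length = n

theorem IsOver.eq_append {y : ∀ i, List (A i)} {x : ∀ i, A i → List (A i)} {k : ℕ}
    (hy : ∀ i, (y i).length = k) (hx : IsOver y x (k + 1)) : x = fun i c => y i ++ [c] := by
  funext i c
  exact ((hx i c).1.eq_of_length (by simp [hy, (hx i c).2])).symm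

theorem IsOver.take {y : ∀ i, List (A i)} {x : ∀ i, A i → List (A i)} {k n m : ℕ}
    (hy : ∀ i, (y i).length = k) (hx : IsOver y x n) (hk : k < m) (hm : m ≤ n) :
    IsOver y (fun i c => (x i c).take m) m := fun i c => by
  have hlen : ((x i c).take m).length = m := by simp [(hx i c).2, hm]
  refine ⟨List.prefix_of_prefix_length_le (hx i c).1 (List.take_prefix _ _) ?_, hlen⟩
  rw [hlen]
  simpa [hy] using hk

theorem restr_append_surjective [∀ i, Inhabited (A i)] (y : ∀ i, List (A i)) :
    Function.Surjective (restr fun i c => y i ++ [c]) := by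
  have hsurj : Function.Surjective
      (fun (a : Letter A) => (fun j => a ⟨j.1, y j.1 ++ [j.2]⟩ : FanLetter A)) := fun a' => by
    let g : ∀ i, A i → A i := fun i c => a' ⟨i, c⟩
    refine ⟨fun x => g x.1 (x.2.getLast?.getD default), funext fun j => ?_⟩
    have hlast : (y j.1 ++ [j.2]).getLast?.getD default = j.2 := by simp
    exact congrArg (g j.1) hlast
  exact List.map_surjective_iff.2 hsurj

/-- The letter whose value at a word is the last entry of that word. -/
def lastLetter (A : ι → Type) [∀ i, Inhabited (A i)] : Letter A :=
  fun x => x.2.getLast?.getD default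

/-- The words of letters beginning with `lastLetter`. -/
def startSet (A : ι → Type) [∀ i, Inhabited (A i)] : Set (FreeMonoid (Letter A)) :=
  {v | ∃ u, v = FreeMonoid.of (lastLetter A) * u}

theorem prefix_readAt_of_mem_startSet [∀ i, Inhabited (A i)] {v : FreeMonoid (Letter A)}
    (hv : v ∈ startSet A) (i : ι) (u : List (A i)) (c : A i) :
    [c] <+: readAt v i (u ++ [c]) := by
  obtain ⟨w, rfl⟩ := hv
  rw [readAt_mul]
  simp [readAt, lastLetter]

theorem mul_mem_startSet [∀ i, Inhabited (A i)] {v : FreeMonoid (Letter A)}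
    (hv : v ∈ startSet A) (w : FreeMonoid (Letter A)) : v * w ∈ startSet A := by
  obtain ⟨u, rfl⟩ := hv
  exact ⟨u * w, mul_assoc _ _ _⟩

/-- A sequence of idempotents in minimal left ideals that is coherent under restriction. -/
structure IsCoherent [∀ i, Inhabited (A i)] (L : ℕ → Set (Ultrafilter (FreeMonoid (Letter A))))
    (q : ℕ → Ultrafilter (FreeMonoid (Letter A))) : Prop where
  isMin : ∀ n, IsMinLeftIdeal (L n)
  mem : ∀ n, q n ∈ L n
  idem : ∀ n, q n * q n = q n
  start : ∀ n, ∀ᶠ v in q n, v ∈ startSet A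
  compat : ∀ n, ∃ e ∈ L n, ∀ a ∈ L (n + 1), ∃ r, r * e.map (dropHom A) = a

theorem exists_isCoherent (A : ι → Type) [∀ i, Inhabited (A i)] :
    ∃ L q, IsCoherent (A := A) L q := by
  have step : ∀ N : {N : Set (Ultrafilter (FreeMonoid (Letter A))) // IsMinLeftIdeal N},
      ∃ N' : {N : Set (Ultrafilter (FreeMonoid (Letter A))) // IsMinLeftIdeal N},
        ∃ e ∈ N.1, ∀ a ∈ N'.1, ∃ r, r * e.map (dropHom A) = a := by
    rintro ⟨N, hN⟩
    obtain ⟨e, he⟩ := hN.nonempty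
    obtain ⟨N', hN', h⟩ := exists_isMinLeftIdeal_subset (e.map (dropHom A))
    exact ⟨⟨N', hN'⟩, e, he, h⟩
  choose f hf using step
  obtain ⟨N₀, hN₀, -⟩ := exists_isMinLeftIdeal_subset (pure 1 : Ultrafilter (FreeMonoid (Letter A)))
  let L := fun n => f^[n] ⟨N₀, hN₀⟩
  have hq := fun n => (L n).2.exists_idem (startSet A) (fun g hg m => mul_mem_startSet hg m)
    ⟨_, 1, rfl⟩
  choose q hqL hq hqs using hq
  refine ⟨fun n => (L n).1, q, fun n => (L n).2, hqL, hq, hqs, fun n => ?_⟩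
  have := hf (L n)
  simpa only [L, Function.iterate_succ_apply'] using this

theorem IsCoherent.map_mem [∀ i, Inhabited (A i)]
    {L : ℕ → Set (Ultrafilter (FreeMonoid (Letter A)))}
    {q : ℕ → Ultrafilter (FreeMonoid (Letter A))} (h : IsCoherent L q) {k : ℕ}
    {y : ∀ i, List (A i)} (hy : ∀ i, (y i).length = k) (m : ℕ) :
    ∀ (x : ∀ i, A i → List (A i)), IsOver y x (k + m + 1) → ∀ a ∈ L (k + m),
      a.map (restr x) ∈ Ultrafilter.map (restr fun i c => y i ++ [c]) '' L k := by
  induction m with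
  | zero =>
    intro x hx a ha
    rw [hx.eq_append hy]
    exact ⟨a, ha, rfl⟩
  | succ m ih =>
    intro x hx a ha
    obtain ⟨e, he, hr⟩ := h.compat (k + m)
    obtain ⟨r, rfl⟩ := hr a ha
    have hmap := ultrafilter_map_mul (restr x).toMulHom r (e.map (dropHom A))
    change (r * e.map (dropHom A)).map (restr x) =
      r.map (restr x) * (e.map (dropHom A)).map (restr x) at hmap
    have hdrop : (fun i c => (x i c).take (k + m + 1)) = fun i c => (x i c).dropLast := by
      funext i c
      rw [List.dropLast_eq_take, (hx i c).2]
      rfl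
    have he' := ih _ (hdrop ▸ hx.take hy (by omega) (by omega)) e he
    rw [hmap, Ultrafilter.map_map,
      show (restr x : _ → _) ∘ dropHom A = restr fun i c => (x i c).dropLast from
        funext fun v => restr_dropHom x v]
    exact ((h.isMin k).map (restr fun i c => y i ++ [c]).toMulHom
      (restr_append_surjective y)).mul_mem _ _ he'

theorem IsCoherent.map_idem [∀ i, Inhabited (A i)]
    {L : ℕ → Set (Ultrafilter (FreeMonoid (Letter A)))}
    {q : ℕ → Ultrafilter (FreeMonoid (Letter A))} (h : IsCoherent L q)
    (x : ∀ i, A i → List (A i)) (n : ℕ) :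
    (q n).map (restr x) * (q n).map (restr x) = (q n).map (restr x) := by
  have := ultrafilter_map_mul (restr x).toMulHom (q n) (q n)
  rw [h.idem] at this
  exact this.symm

/-- The word accumulated between stages `k` and `k + m` along the branch `u`. -/
def segment (v : ℕ → FreeMonoid (Letter A)) (i : ι) (k : ℕ) : ℕ → List (A i) → List (A i)
  | 0, _ => []
  | m + 1, u => segment v i k m u ++ readAt (v (k + m)) i (u.take (k + m + 1))

/-- The fan word accumulated between stages `k` and `k + m` along the branches `x`. -/
def fanWord (v : ℕ → FreeMonoid (Letter A)) (k : ℕ) (x : ∀ i, A i → List (A i)) :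
    ℕ → FreeMonoid (FanLetter A)
  | 0 => 1
  | m + 1 => fanWord v k x m * restr (fun i c => (x i c).take (k + m + 1)) (v (k + m))

/-- The nodes of the tree generated by `v`. -/
def node (v : ℕ → FreeMonoid (Letter A)) (i : ι) (u : List (A i)) : List (A i) :=
  segment v i 0 u.length u

theorem readFan_fanWord (v : ℕ → FreeMonoid (Letter A)) (k : ℕ) (x : ∀ i, A i → List (A i))
    (m : ℕ) (i : ι) (c : A i) : readFan (fanWord v k x m) i c = segment v i k m (x i c) := by
  induction m with
  | zero => simp [fanWord, segment, readFan_one]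
  | succ m ih => simp [fanWord, segment, readFan_mul, readFan_restr, ih]

theorem segment_add (v : ℕ → FreeMonoid (Letter A)) (i : ι) (k m : ℕ) (u : List (A i)) :
    segment v i 0 (k + m) u = segment v i 0 k u ++ segment v i k m u := by
  induction m with
  | zero => simp [segment]
  | succ m ih => simp [segment, ← add_assoc, ih]

theorem segment_congr {v v' : ℕ → FreeMonoid (Letter A)} {i : ι} {k m : ℕ} {u u' : List (A i)}
    (hv : ∀ j, k ≤ j → j < k + m → v j = v' j) (hu : u.take (k + m) = u'.take (k + m)) :
    segment v i k m u = segment v' i k m u' := by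
  induction m with
  | zero => rfl
  | succ m ih =>
    have hu' : u.take (k + m) = u'.take (k + m) := by
      have := congrArg (List.take (k + m)) hu
      simpa [List.take_take] using this
    rw [segment, segment, ih (fun j h1 h2 => hv j h1 (by omega)) hu', hv (k + m) (by omega)
      (by omega), add_assoc, hu]

theorem fanWord_congr {v v' : ℕ → FreeMonoid (Letter A)} {k m : ℕ}
    {x x' : ∀ i, A i → List (A i)} (hv : ∀ j, k ≤ j → j < k + m → v j = v' j)
    (hx : ∀ i c, (x i c).take (k + m) = (x' i c).take (k + m)) :
    fanWord v k x m = fanWord v' k x' m := by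
  induction m with
  | zero => rfl
  | succ m ih =>
    have hx' : ∀ i c, (x i c).take (k + m) = (x' i c).take (k + m) := fun i c => by
      have := congrArg (List.take (k + m)) (hx i c)
      simpa [List.take_take] using this
    have hx'' : ∀ i c, (x i c).take (k + m + 1) = (x' i c).take (k + m + 1) := hx
    rw [fanWord, fanWord, ih (fun j h1 h2 => hv j h1 (by omega)) hx', hv (k + m) (by omega)
      (by omega)]
    simp only [hx'']

theorem length_segment (v : ℕ → FreeMonoid (Letter A)) (i : ι) (k m : ℕ) (u : List (A i)) :
    (segment v i k m u).length = ∑ j ∈ Finset.range m, (v (k + j)).length := by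
  induction m with
  | zero => rfl
  | succ m ih => rw [segment, List.length_append, ih, length_readAt, Finset.sum_range_succ]

theorem node_congr {v v' : ℕ → FreeMonoid (Letter A)} {i : ι} {u : List (A i)}
    (hv : ∀ j < u.length, v j = v' j) : node v i u = node v' i u :=
  segment_congr (fun j _ h => hv j (by omega)) rfl

end Words

section Fusion

attribute [local instance] Ultrafilter.mul Ultrafilter.semigroup

theorem exists_forall_of_step {M : Type*} [Inhabited M] (Inv : ℕ → (ℕ → M) → Prop)
    (congr : ∀ n u v, (∀ i < n, u i = v i) → Inv n u → Inv n v) (zero : ∀ v, Inv 0 v)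
    (step : ∀ n v, Inv n v → ∃ a, Inv (n + 1) (Function.update v n a)) : ∃ v, ∀ n, Inv n v := by
  choose! a ha using step
  let F : ∀ n, {v // Inv n v} := fun n => Nat.rec ⟨default, zero _⟩
    (fun n v => ⟨Function.update v.1 n (a n v.1), ha n v.1 v.2⟩) n
  have hF : ∀ n, (F (n + 1)).1 = Function.update (F n).1 n (a n (F n).1) := fun n => rfl
  have hagree : ∀ n, ∀ i < n, (F n).1 i = (F (i + 1)).1 i := by
    intro n
    induction n with
    | zero => intro i hi; omega
    | succ n ih =>
      intro i hi
      rcases Nat.lt_succ_iff_lt_or_eq.1 hi with h | rfl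
      · rw [hF, Function.update_of_ne h.ne, ih i h]
      · rfl
  exact ⟨fun n => (F (n + 1)).1 n, fun n => congr n _ _ (hagree n) (F n).2⟩

theorem eventually_pure_mul {M : Type*} [Mul M] (z : M) (Q : Ultrafilter M) (p : M → Prop) :
    (∀ᶠ m in ((pure z * Q : Ultrafilter M) : Filter M), p m) ↔ ∀ᶠ m in Q, p (z * m) := by
  rw [Ultrafilter.eventually_mul, Ultrafilter.coe_pure, eventually_pure]

variable {ι : Type} {A : ι → Type}

theorem finite_setOf_isOver [Finite ι] [∀ i, Finite (A i)] (y : ∀ i, List (A i)) (n : ℕ) :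
    {x | IsOver y x n}.Finite := by
  have : (Set.univ.pi fun i : ι => Set.univ.pi fun _ : A i =>
      {u : List (A i) | u.length = n}).Finite :=
    Set.Finite.pi fun i => Set.Finite.pi fun _ => List.finite_length_eq _ _
  exact this.subset fun x hx i _ c _ => (hx i c).2

theorem finite_setOf_length [Finite ι] [∀ i, Finite (A i)] (k : ℕ) :
    {y : ∀ i, List (A i) | ∀ i, (y i).length = k}.Finite := by
  have : (Set.univ.pi fun i : ι => {u : List (A i) | u.length = k}).Finite :=
    Set.Finite.pi fun i => List.finite_length_eq _ _
  exact this.subset fun x hx i _ => hx i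

theorem IsCoherent.fusion [Finite ι] [∀ i, Finite (A i)] [∀ i, Inhabited (A i)]
    {L : ℕ → Set (Ultrafilter (FreeMonoid (Letter A)))}
    {q : ℕ → Ultrafilter (FreeMonoid (Letter A))} (h : IsCoherent L q) {I : Type}
    (C : (∀ i, List (A i)) → (∀ i, List (A i)) → Set I)
    (U : (∀ i, List (A i)) → (∀ i, List (A i)) → I → Set (FreeMonoid (FanLetter A)))
    (V : (∀ i, List (A i)) → (∀ i, List (A i)) → I → ℕ → Set (FreeMonoid (FanLetter A)))
    (hC : ∀ y s, (∃ m, ∀ i, (s i).length = m) → (C y s).Finite)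
    (hU : ∀ k y s, (∀ i, (y i).length = k) → (∃ m, ∀ i, (s i).length = m) → ∀ w ∈ C y s,
      ∀ᶠ z in (q k).map (restr fun i c => y i ++ [c]), z ∈ U y s w)
    (hV : ∀ k y s, (∀ i, (y i).length = k) → (∃ m, ∀ i, (s i).length = m) → ∀ w ∈ C y s,
      ∀ σ ∈ Ultrafilter.map (restr fun i c => y i ++ [c]) '' L k,
        (∀ᶠ z in σ, z ∈ U y s w) → ∀ n, k < n → ∀ᶠ z in σ, z ∈ V y s w n) :
    ∃ v : ℕ → FreeMonoid (Letter A), (∀ n, v n ∈ startSet A) ∧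
      ∀ k y, (∀ i, (y i).length = k) → ∀ w ∈ C y fun i => node v i (y i),
        ∀ m x, 0 < m → IsOver y x (k + m) →
          fanWord v k x m ∈ V y (fun i => node v i (y i)) w (k + m) := by
  have balanced : ∀ v : ℕ → FreeMonoid (Letter A), ∀ k, ∀ y : ∀ i, List (A i),
      (∀ i, (y i).length = k) → ∃ m, ∀ i, (node v i (y i)).length = m := by
    intro v k y hy
    exact ⟨_, fun i => by rw [node, hy, length_segment]⟩
  let Inv : ℕ → (ℕ → FreeMonoid (Letter A)) → Prop := fun n v =>
    (∀ j < n, v j ∈ startSet A) ∧ ∀ k m, k + m = n → ∀ y, (∀ i, (y i).length = k) →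
      ∀ w ∈ C y fun i => node v i (y i),
        (∀ x, 0 < m → IsOver y x n → fanWord v k x m ∈ V y (fun i => node v i (y i)) w n) ∧
        ∀ x, IsOver y x (n + 1) →
          ∀ᶠ z in ((pure (fanWord v k x m) * (q n).map (restr x) :
            Ultrafilter (FreeMonoid (FanLetter A))) : Filter (FreeMonoid (FanLetter A))),
            z ∈ U y (fun i => node v i (y i)) w
  have nodes_congr : ∀ (n : ℕ) (u v : ℕ → FreeMonoid (Letter A)), (∀ j < n, u j = v j) →
      ∀ k ≤ n, ∀ y : ∀ i, List (A i), (∀ i, (y i).length = k) →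
        (fun i => node u i (y i)) = fun i => node v i (y i) := by
    intro n u v huv k hk y hy
    funext i
    exact node_congr fun j hj => huv j (by rw [hy] at hj; omega)
  have fan_root : ∀ (v : ℕ → FreeMonoid (Letter A)) k y, (∀ i, (y i).length = k) →
      ∀ w ∈ C y fun i => node v i (y i), ∀ x, IsOver y x (k + 1) →
          ∀ᶠ z in ((pure (fanWord v k x 0) * (q k).map (restr x) :
            Ultrafilter (FreeMonoid (FanLetter A))) : Filter (FreeMonoid (FanLetter A))),
            z ∈ U y (fun i => node v i (y i)) w := by
    intro v k y hy w hw x hx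
    rw [eventually_pure_mul, hx.eq_append hy]
    simpa only [fanWord, one_mul] using hU k y _ hy (balanced v k y hy) w hw
  suffices hex : ∃ v, ∀ n, Inv n v by
    obtain ⟨v, hv⟩ := hex
    refine ⟨v, fun n => (hv (n + 1)).1 n n.lt_succ_self, fun k y hy w hw m x hm hx => ?_⟩
    exact ((hv (k + m)).2 k m rfl y hy w hw).1 x hm hx
  refine exists_forall_of_step Inv ?_ ?_ ?_
  · rintro n u v huv ⟨hs, hI⟩
    refine ⟨fun j hj => huv j hj ▸ hs j hj, ?_⟩
    intro k m hkm y hy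
    have hfan : ∀ x, fanWord u k x m = fanWord v k x m := fun x =>
      fanWord_congr (fun j _ hj => huv j (by omega)) fun _ _ => rfl
    have := hI k m hkm y hy
    simpa only [nodes_congr n u v huv k (by omega) y hy, hfan] using this
  · intro v
    refine ⟨fun j hj => absurd hj (by omega), fun k m hkm y hy w hw => ?_⟩
    obtain ⟨rfl, rfl⟩ : k = 0 ∧ m = 0 := by omega
    exact ⟨fun x hm => absurd hm (by omega), fun x hx => fan_root v 0 y hy w hw x hx⟩
  · rintro n v ⟨hs, hI⟩
    have key : ∀ᶠ a in q n, ∀ k ∈ Set.Iic n, ∀ y ∈ {y : ∀ i, List (A i) | ∀ i, (y i).length = k},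
        ∀ w ∈ C y fun i => node v i (y i), (∀ x ∈ {x | IsOver y x (n + 1)},
          fanWord v k x (n - k) * restr x a ∈ V y (fun i => node v i (y i)) w (n + 1)) ∧
        ∀ x ∈ {x | IsOver y x (n + 2)},
          ∀ᶠ z in (q (n + 1)).map (restr x), fanWord v k x (n - k) *
            restr (fun i c => (x i c).take (n + 1)) a * z ∈ U y (fun i => node v i (y i)) w := by
      refine (Set.finite_Iic n).eventually_all.2 fun k hk => ?_
      refine (finite_setOf_length k).eventually_all.2 fun y hy => ?_
      refine (hC y _ (balanced v k y hy)).eventually_all.2 fun w hw => ?_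
      have hk' : k + (n - k) = n := by have : k ≤ n := hk; omega
      have hmin := (h.isMin k).map (restr fun i c => y i ++ [c]).toMulHom
        (restr_append_surjective y)
      have hmem : ∀ x, IsOver y x (n + 1) → (q n).map (restr x) ∈
          Ultrafilter.map (restr fun i c => y i ++ [c]) '' L k := fun x hx => by
        have := h.map_mem hy (n - k) x (by rwa [hk']) (q n) (by rw [hk']; exact h.mem n)
        exact this
      refine ((finite_setOf_isOver y _).eventually_all.2 fun x hx => ?_).and
        ((finite_setOf_isOver y _).eventually_all.2 fun x hx => ?_)
      · have hUx := (hI k (n - k) hk' y hy w hw).2 x hx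
        have := hV k y _ hy (balanced v k y hy) w hw _ (hmin.mul_mem _ _ (hmem x hx)) hUx (n + 1)
          (by have : k ≤ n := hk; omega)
        rw [eventually_pure_mul] at this
        exact this
      · have hkn : k ≤ n := hk
        have hx' : IsOver y (fun i c => (x i c).take (n + 1)) (n + 1) :=
          IsOver.take hy hx (by omega) (by omega)
        have hUx := (hI k (n - k) hk' y hy w hw).2 _ hx'
        have hQ : (q (n + 1)).map (restr x) ∈
            Ultrafilter.map (restr fun i c => y i ++ [c]) '' L k := by
          have e : k + (n + 1 - k) = n + 1 := by omega
          exact h.map_mem hy (n + 1 - k) x (by rwa [e]) (q (n + 1)) (by rw [e]; exact h.mem _)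
        rw [← hmin.mul_idem (hmin.mul_mem _ _ (hmem _ hx')) hQ (h.map_idem x (n + 1)),
          Ultrafilter.eventually_mul, eventually_pure_mul,
          show fanWord v k (fun i c => (x i c).take (n + 1)) (n - k) = fanWord v k x (n - k) from
            fanWord_congr (fun _ _ _ => rfl) fun i c => by
              rw [List.take_take, min_eq_left (by omega)]] at hUx
        exact hUx
    obtain ⟨a, ha, has⟩ := (key.and (h.start n)).exists
    have hupd : ∀ j < n, v j = Function.update v n a j := fun j hj =>
      (Function.update_of_ne hj.ne _ _).symm
    refine ⟨a, fun j hj => ?_, ?_⟩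
    · rcases Nat.lt_succ_iff_lt_or_eq.1 hj with hj | rfl
      · rw [← hupd j hj]
        exact hs j hj
      · simpa using has
    · intro k m hkm y hy w hw
      rcases m with _ | m
      · obtain rfl : k = n + 1 := hkm
        exact ⟨fun x hm => absurd hm (by omega), fan_root _ _ y hy w hw⟩
      · obtain rfl : n = k + m := by omega
        rw [← nodes_congr _ v _ hupd k (by omega) y hy] at hw ⊢
        obtain ⟨h1, h2⟩ := ha k (by simp) y hy w hw
        have hfan : ∀ x, fanWord (Function.update v (k + m) a) k x (m + 1) =
            fanWord v k x m * restr (fun i c => (x i c).take (k + m + 1)) a := fun x => by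
          rw [fanWord, Function.update_self, fanWord_congr (fun j _ hj => (hupd j hj).symm)
            fun _ _ => rfl]
        simp only [Nat.add_sub_cancel_left] at h1 h2
        refine ⟨fun x _ hx => ?_, fun x hx => ?_⟩
        · have htake : (fun i c => (x i c).take (k + m + 1)) = x := by
            funext i c
            exact List.take_of_length_le (hx i c).2.le
          rw [hfan, htake]
          exact h1 x hx
        · rw [eventually_pure_mul, hfan]
          exact h2 x hx

end Fusion

section Core

attribute [local instance] Ultrafilter.mul Ultrafilter.semigroup

/-- A map of words that maps words of length `n` to words of length `l n` and respects
one-letter extensions. -/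
structure IsStrongMap {α : Type} (h : List α → List α) (l : ℕ → ℕ) : Prop where
  length : ∀ x, (h x).length = l x.length
  append : ∀ x c, h x ++ [c] <+: h (x ++ [c])

variable {ι : Type} {A : ι → Type}

theorem isStrongMap_segment [∀ i, Inhabited (A i)] {v : ℕ → FreeMonoid (Letter A)}
    (hv : ∀ n, v n ∈ startSet A) (i : ι) (s y : List (A i)) :
    IsStrongMap (fun x => s ++ segment v i y.length x.length (y ++ x))
      (fun n => s.length + ∑ j ∈ Finset.range n, (v (y.length + j)).length) where
  length x := by rw [List.length_append, length_segment]
  append x c := by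
    rw [List.length_append, List.length_singleton, segment, ← List.append_assoc y x [c],
      List.take_of_length_le (by simp [add_assoc]), List.append_assoc, List.prefix_append_right_inj,
      segment_congr (v := v) (v' := v) (u := y ++ x ++ [c]) (u' := y ++ x) (fun _ _ _ => rfl) (by
        rw [List.take_append_of_le_length (by simp)]), List.prefix_append_right_inj]
    exact prefix_readAt_of_mem_startSet (hv _) i _ c

theorem isStrongMap_node [∀ i, Inhabited (A i)] {v : ℕ → FreeMonoid (Letter A)}
    (hv : ∀ n, v n ∈ startSet A) (i : ι) :
    IsStrongMap (node v i) (fun n => ∑ j ∈ Finset.range n, (v j).length) := by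
  have h := isStrongMap_segment hv i [] []
  simp only [List.nil_append, List.length_nil, zero_add] at h
  exact h

theorem fanWord_update_mul (v : ℕ → FreeMonoid (Letter A)) (k : ℕ) (x : ∀ i, A i → List (A i))
    (a : FreeMonoid (Letter A)) (m : ℕ) :
    fanWord (Function.update v k (a * v k)) k x (m + 1) =
      restr (fun i c => (x i c).take (k + 1)) a * fanWord v k x (m + 1) := by
  induction m with
  | zero => simp [fanWord]
  | succ m ih =>
    rw [fanWord, ih, Function.update_of_ne (by omega), mul_assoc]
    rfl

theorem node_eq_append_readFan (v : ℕ → FreeMonoid (Letter A)) {k m : ℕ} {y : ∀ i, List (A i)}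
    {x : ∀ i, A i → List (A i)} (hy : ∀ i, (y i).length = k) (hx : IsOver y x (k + m)) (i : ι)
    (c : A i) : node v i (x i c) = node v i (y i) ++ readFan (fanWord v k x m) i c := by
  obtain ⟨⟨u, hu⟩, hlen⟩ := hx i c
  rw [readFan_fanWord, node, hlen, segment_add, node, hy,
    segment_congr (v' := v) (u' := y i) (fun _ _ _ => rfl)]
  rw [← hu, zero_add, List.append_assoc, List.take_append_of_le_length (hy i).ge]

theorem exists_pos_forall_lt {n : ℕ} {θ : ℕ → ℝ} (hθ : ∀ p < n, 0 < θ p) :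
    ∃ η, 0 < η ∧ ∀ p < n, η < θ p := by
  have h : ∀ᶠ η in nhdsWithin (0 : ℝ) (Set.Ioi 0), ∀ p ∈ Set.Iio n, η < θ p :=
    (Set.finite_Iio n).eventually_all.2 fun p hp =>
      mem_of_superset (Ioo_mem_nhdsGT (hθ p hp)) fun _ hη => hη.2
  exact ((eventually_mem_nhdsWithin (s := Set.Ioi (0 : ℝ))).and h).exists

/-- Along `σ` the function `f` is eventually below every positive bound. -/
def IsNull {X : Type*} (f : X → ℝ) (σ : Ultrafilter X) : Prop :=
  ∀ θ, 0 < θ → ∀ᶠ z in σ, f z ≤ θ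

theorem IsCoherent.exists_isNull [Finite ι] [Nonempty ι] [∀ i, Finite (A i)]
    [∀ i, Inhabited (A i)]
    {L : ℕ → Set (Ultrafilter (FreeMonoid (Letter A)))}
    {q : ℕ → Ultrafilter (FreeMonoid (Letter A))} (h : IsCoherent L q) {N : ℕ}
    (g : ℕ → (∀ i, A i → List (A i)) → ℝ) {s : ∀ i, List (A i)}
    (hs : ∃ m, ∀ i, (s i).length = m)
    (hg : ∀ θ, 0 < θ → ∀ (r : ∀ i, List (A i) → List (A i)) (l : ℕ → ℕ),
      (∀ i, IsStrongMap (r i) l) → (∀ i, r i [] = s i) → ∃ x m, 0 < m ∧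
        IsOver (fun _ => []) x m ∧ ∃ p < N, g p (fun i c => r i (x i c)) ≤ θ)
    {k : ℕ} {y : ∀ i, List (A i)} (hy : ∀ i, (y i).length = k) {a : FreeMonoid (Letter A)}
    (ha : a ∈ startSet A) :
    ∃ p < N, IsNull (fun z => g p fun i c => s i ++ readFan z i c)
      (pure (restr (fun i c => y i ++ [c]) a) * (q k).map (restr fun i c => y i ++ [c])) := by
  by_contra! hcon
  simp only [IsNull, not_forall] at hcon
  choose! θ hθ hcon using hcon
  obtain ⟨η, hη, hηθ⟩ := exists_pos_forall_lt hθ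
  obtain ⟨v, hv, hfan⟩ := h.fusion (I := Unit) (fun y' _ => {_w | y' = y})
    (fun _ _ _ => {z | ∀ p ∈ Set.Iio N, η < g p fun i c =>
      s i ++ readFan (restr (fun i c => y i ++ [c]) a * z) i c})
    (fun _ _ _ _ => {z | ∀ p ∈ Set.Iio N, η < g p fun i c =>
      s i ++ readFan (restr (fun i c => y i ++ [c]) a * z) i c})
    (fun _ _ _ => Set.toFinite _) (by
      rintro k' y' s' hy' - w (rfl : y' = y)
      obtain rfl : k' = k := (hy' (Classical.arbitrary ι)).symm.trans (hy _)
      refine (Set.finite_Iio N).eventually_all.2 fun p hp => ?_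
      have := Ultrafilter.eventually_not.2 (hcon p hp)
      rw [eventually_pure_mul] at this
      filter_upwards [this] with z hz
      exact (hηθ p hp).trans (not_le.1 hz))
    (fun _ _ _ _ _ _ _ _ _ hU _ _ => hU)
  obtain ⟨m₀, hm₀⟩ := hs
  set v' := Function.update v k (a * v k) with hv'
  have hv's : ∀ n, v' n ∈ startSet A := fun n => by
    rcases eq_or_ne n k with rfl | hn
    · rw [hv', Function.update_self]
      exact mul_mem_startSet ha _
    · rw [hv', Function.update_of_ne hn]
      exact hv n
  obtain ⟨x, m, hm, hx, p, hp, hle⟩ := hg η hη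
    (fun i x => s i ++ segment v' i k x.length (y i ++ x))
    (fun n => m₀ + ∑ j ∈ Finset.range n, (v' (k + j)).length)
    (fun i => by simpa only [hy, hm₀] using isStrongMap_segment hv's i (s i) (y i))
    (fun i => by simp [segment])
  obtain ⟨m, rfl⟩ := Nat.exists_eq_succ_of_ne_zero hm.ne'
  have hX : IsOver y (fun i c => y i ++ x i c) (k + (m + 1)) := fun i c =>
    ⟨(List.prefix_append_right_inj _).2 (hx i c).1, by rw [List.length_append, hy, (hx i c).2]⟩
  have hlt := hfan k y hy () rfl (m + 1) _ hm hX p hp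
  refine absurd hle (not_le.2 (hlt.trans_eq (congrArg (g p) ?_)))
  have htake : (fun i c => (y i ++ x i c).take (k + 1)) = fun i c => y i ++ [c] :=
    (hX.take hy k.lt_succ_self (by omega)).eq_append hy
  funext i c
  rw [← htake, ← fanWord_update_mul, readFan_fanWord, (hx i c).2]

theorem IsCoherent.isNull_of_eventually_pure_mul [∀ i, Inhabited (A i)]
    {L : ℕ → Set (Ultrafilter (FreeMonoid (Letter A)))}
    {q : ℕ → Ultrafilter (FreeMonoid (Letter A))} (h : IsCoherent L q) {k : ℕ}
    {y : ∀ i, List (A i)} {f : FreeMonoid (FanLetter A) → ℝ}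
    {σ : Ultrafilter (FreeMonoid (FanLetter A))}
    (hσ : σ ∈ Ultrafilter.map (restr fun i c => y i ++ [c]) '' L k)
    (hf : ∀ᶠ z in σ, IsNull f (pure z * (q k).map (restr fun i c => y i ++ [c]))) :
    IsNull f σ := by
  have hmin : IsMinLeftIdeal (Ultrafilter.map (restr fun i c => y i ++ [c]) '' L k) :=
    (h.isMin k).map (restr fun i c => y i ++ [c]).toMulHom (restr_append_surjective y)
  have hmul := hmin.mul_idem hσ (Set.mem_image_of_mem _ (h.mem k)) (h.map_idem _ k)
  intro θ hθ
  rw [← hmul, Ultrafilter.eventually_mul]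
  filter_upwards [hf] with z hz
  exact (eventually_pure_mul _ _ _).1 (hz θ hθ)

theorem exists_sparse_strongMap [Finite ι] [Nonempty ι] [∀ i, Finite (A i)]
    [∀ i, Inhabited (A i)] {I : Type}
    {N : ℕ} (C : (∀ i, List (A i)) → Set I)
    (g : (∀ i, List (A i)) → I → ℕ → (∀ i, A i → List (A i)) → ℝ)
    (hC : ∀ s : ∀ i, List (A i), (∃ m, ∀ i, (s i).length = m) → (C s).Finite)
    (hg : ∀ s : ∀ i, List (A i), (∃ m, ∀ i, (s i).length = m) → ∀ w ∈ C s, ∀ θ, 0 < θ →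
      ∀ (r : ∀ i, List (A i) → List (A i)) (l : ℕ → ℕ),
      (∀ i, IsStrongMap (r i) l) → (∀ i, r i [] = s i) → ∃ x m, 0 < m ∧
        IsOver (fun _ => []) x m ∧ ∃ p < N, g s w p (fun i c => r i (x i c)) ≤ θ)
    {θ : ℕ → ℝ} (hθ : ∀ n, 0 < n → 0 < θ n) :
    ∃ (r : ∀ i, List (A i) → List (A i)) (l : ℕ → ℕ), (∀ i, IsStrongMap (r i) l) ∧
      ∀ k y, (∀ i, (y i).length = k) → ∀ w ∈ C fun i => r i (y i), ∃ p < N, ∀ n, k < n →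
        ∀ x, IsOver y x n →
          g (fun i => r i (y i)) w p (fun i c => r i (x i c)) ≤ θ n := by
  obtain ⟨L, q, h⟩ := exists_isCoherent A
  have hpig : ∀ k (y s : ∀ i, List (A i)) w, (∀ i, (y i).length = k) →
      (∃ m, ∀ i, (s i).length = m) → w ∈ C s → ∃ p < N,
        ∀ᶠ z in (q k).map (restr fun i c => y i ++ [c]),
          IsNull (fun z => g s w p fun i c => s i ++ readFan z i c)
            (pure z * (q k).map (restr fun i c => y i ++ [c])) := by
    intro k y s w hy hs hw
    refine (Ultrafilter.eventually_exists_mem_iff (Set.finite_Iio N)).1 ?_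
    rw [Ultrafilter.coe_map, eventually_map]
    filter_upwards [h.start k] with a ha
    exact h.exists_isNull (g s w) hs (hg s hs w hw) hy ha
  choose! P hPN hP using hpig
  obtain ⟨i₀⟩ := ‹Nonempty ι›
  obtain ⟨v, hv, hfan⟩ := h.fusion (fun _ s => C s)
    (fun y s w => {z | IsNull (fun z => g s w (P (y i₀).length y s w) fun i c =>
      s i ++ readFan z i c) (pure z * (q (y i₀).length).map (restr fun i c => y i ++ [c]))})
    (fun y s w n => {z | g s w (P (y i₀).length y s w) (fun i c => s i ++ readFan z i c) ≤ θ n})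
    (fun _ s hs => hC s hs) (by
      intro k y s hy hs w hw
      simp only [hy i₀]
      exact hP k y s w hy hs hw) (by
      intro k y s hy hs w hw σ hσ hU n hn
      simp only [hy i₀] at hU ⊢
      exact h.isNull_of_eventually_pure_mul hσ hU (θ n) (hθ n (by omega)))
  refine ⟨node v, _, isStrongMap_node hv, fun k y hy w hw => ?_⟩
  have hs : ∃ m, ∀ i, (node v i (y i)).length = m :=
    ⟨_, fun i => by rw [(isStrongMap_node hv i).length, hy]⟩
  refine ⟨P k y (fun i => node v i (y i)) w, hPN k y _ w hy hs hw, fun n hn x hx => ?_⟩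
  obtain ⟨m, rfl⟩ := Nat.exists_eq_add_of_le hn.le
  have := hfan k y hy w hw m x (by omega) hx
  simp only [hy i₀, Set.mem_ofPred_eq, ← node_eq_append_readFan v hy hx] at this
  exact this

end Core

section Coding

theorem prefix_antisymm {α : Type*} {x y : List α} (hxy : x <+: y) (hyx : y <+: x) : x = y :=
  hxy.eq_of_length (le_antisymm hxy.length_le hyx.length_le)

theorem eq_of_append_singleton_prefix {α : Type*} {x y : List α} {a b : α}
    (ha : x ++ [a] <+: y) (hb : x ++ [b] <+: y) : a = b := by
  have h := List.prefix_of_prefix_length_le ha hb (by simp)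
  simpa using h

theorem exists_append_singleton_prefix {α : Type*} {x y : List α} (hxy : x <+: y) (hne : x ≠ y) :
    ∃ c, x ++ [c] <+: y := by
  obtain ⟨_ | ⟨c, t⟩, rfl⟩ := hxy
  · simp at hne
  · exact ⟨c, t, by simp⟩

theorem finite_setOf_prefix {α : Type*} (x : List α) : {y | y <+: x}.Finite := by
  refine ((Set.finite_Iic x.length).image fun k => x.take k).subset fun y hy => ?_
  exact ⟨y.length, List.IsPrefix.length_le hy, (List.prefix_iff_eq_take.1 hy).symm⟩

theorem ncard_strict_prefixes {α : Type*} (x : List α) :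
    {y | y <+: x ∧ y ≠ x}.ncard = x.length := by
  have himage : {y | y <+: x ∧ y ≠ x} = (fun k => x.take k) '' (Finset.range x.length : Set ℕ) := by
    ext y
    simp only [Set.mem_ofPred_eq, Set.mem_image, Finset.coe_range, Set.mem_Iio]
    constructor
    · rintro ⟨hy, hne⟩
      exact ⟨y.length, lt_of_le_of_ne hy.length_le fun h => hne (hy.eq_of_length h),
        (List.prefix_iff_eq_take.1 hy).symm⟩
    · rintro ⟨k, hk, rfl⟩
      refine ⟨List.take_prefix _ _, fun h => ?_⟩
      have := congrArg List.length h
      simp at this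
      omega
  rw [himage, Set.InjOn.ncard_image, Set.ncard_coe_finset, Finset.card_range]
  intro k hk k' hk' h
  have := congrArg List.length h
  simp at this hk hk'
  omega

/-- A map of words into words that preserves and reflects end-extension. -/
def IsPrefixEmbedding {α β : Type*} (f : List α → List β) : Prop :=
  ∀ x y, f x <+: f y ↔ x <+: y

theorem IsPrefixEmbedding.injective {α β : Type*} {f : List α → List β}
    (hf : IsPrefixEmbedding f) : Function.Injective f := fun x y h =>
  prefix_antisymm ((hf x y).1 (h ▸ List.prefix_rfl)) ((hf y x).1 (h ▸ List.prefix_rfl))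

theorem IsPrefixEmbedding.level_image {α : Type*} {f : List α → List ℕ}
    (hf : IsPrefixEmbedding f) {X : Set (List α)} (hX : ∀ x ∈ X, ∀ y, y <+: x → y ∈ X) (n : ℕ) :
    level (f '' X) n = f '' {x ∈ X | x.length = n} := by
  have key : ∀ x ∈ X, {s ∈ f '' X | s <+: f x ∧ s ≠ f x}.ncard = x.length := by
    intro x hx
    rw [← ncard_strict_prefixes x, ← Set.ncard_image_of_injective _ hf.injective]
    congr 1
    ext s
    constructor
    · rintro ⟨⟨y, -, rfl⟩, h1, h2⟩
      exact ⟨y, ⟨(hf _ _).1 h1, fun h => h2 (h ▸ rfl)⟩, rfl⟩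
    · rintro ⟨y, ⟨h1, h2⟩, rfl⟩
      exact ⟨⟨y, hX x hx y h1, rfl⟩, (hf _ _).2 h1, fun h => h2 (hf.injective h)⟩
  ext s
  constructor
  · rintro ⟨⟨x, hx, rfl⟩, h⟩
    exact ⟨x, ⟨hx, (key x hx).symm.trans h⟩, rfl⟩
  · rintro ⟨x, ⟨hx, h⟩, rfl⟩
    exact ⟨⟨x, hx, rfl⟩, (key x hx).trans h⟩

theorem IsPrefixEmbedding.mem_level {α : Type*} {f : List α → List ℕ}
    (hf : IsPrefixEmbedding f) {x : List α} {n : ℕ} :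
    f x ∈ level (Set.range f) n ↔ x.length = n := by
  rw [← Set.image_univ, hf.level_image (fun _ _ _ _ => Set.mem_univ _), hf.injective.mem_set_image]
  simp

theorem IsPrefixEmbedding.level_zero {α : Type*} {f : List α → List ℕ}
    (hf : IsPrefixEmbedding f) : level (Set.range f) 0 = {f []} := by
  ext s
  constructor
  · intro hs
    obtain ⟨x, rfl⟩ := hs.1
    rw [List.length_eq_zero_iff.1 (hf.mem_level.1 hs)]
    rfl
  · rintro rfl
    exact hf.mem_level.2 rfl

theorem IsPrefixEmbedding.immSuc {α : Type*} {f : List α → List ℕ}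
    (hf : IsPrefixEmbedding f) {x : List α} {s : List ℕ} :
    ImmSuc (Set.range f) (f x) s ↔ ∃ c, s = f (x ++ [c]) := by
  constructor
  · rintro ⟨-, ⟨y, rfl⟩, hxy, hne, h⟩
    obtain ⟨c, hc⟩ := exists_append_singleton_prefix ((hf _ _).1 hxy) fun h => hne (h ▸ rfl)
    refine ⟨c, ?_⟩
    rcases h (f (x ++ [c])) ⟨_, rfl⟩ ((hf _ _).2 (List.prefix_append _ _)) ((hf _ _).2 hc)
      with h | h
    · simpa using hf.injective h
    · exact h.symm
  · rintro ⟨c, rfl⟩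
    refine ⟨⟨_, rfl⟩, ⟨_, rfl⟩, (hf _ _).2 (List.prefix_append _ _), fun h => ?_, ?_⟩
    · simpa using hf.injective h
    · rintro _ ⟨y, rfl⟩ hxy hy
      rw [hf] at hxy hy
      rcases List.prefix_concat_iff.1 hy with rfl | hy
      · exact Or.inr rfl
      · exact Or.inl (congrArg f (prefix_antisymm hy hxy))

theorem isPrefixEmbedding_map_val (b : ℕ) :
    IsPrefixEmbedding (List.map (Fin.val : Fin b → ℕ)) := fun _ _ =>
  List.prefix_map_iff_of_injective Fin.val_injective

theorem range_map_val (b : ℕ) : Set.range (List.map (Fin.val : Fin b → ℕ)) = bSeq b := by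
  rw [Set.range_list_map]
  simp [bSeq]

variable {α : Type} {h : List α → List α} {l : ℕ → ℕ}

theorem IsStrongMap.isPrefixEmbedding (hh : IsStrongMap h l) : IsPrefixEmbedding h := by
  have mono : ∀ x z, h x <+: h (x ++ z) := by
    intro x z
    induction z using List.reverseRecOn with
    | nil => simp
    | append_singleton z c ih =>
      rw [← List.append_assoc]
      exact ih.trans ((List.prefix_append _ _).trans (hh.append _ c))
  intro x y
  constructor
  · induction x using List.reverseRecOn with
    | nil => simp
    | append_singleton x c ih =>
      intro hxy
      have hc := (hh.append x c).trans hxy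
      obtain ⟨_ | ⟨d, z⟩, rfl⟩ := ih ((List.prefix_append _ _).trans hc)
      · have := hc.length_le
        simp at this
      · have hd : h x ++ [d] <+: h (x ++ d :: z) := by
          have := mono (x ++ [d]) z
          rw [List.append_assoc] at this
          exact (hh.append x d).trans this
        obtain rfl := eq_of_append_singleton_prefix hc hd
        exact ⟨z, by simp⟩
  · rintro ⟨z, rfl⟩
    exact mono x z

theorem IsStrongMap.strictMono [Inhabited α] (hh : IsStrongMap h l) : StrictMono l := by
  refine strictMono_nat_of_lt_succ fun n => ?_
  have := (hh.append (List.replicate n default) default).length_le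
  simpa [hh.length, Nat.succ_le_iff] using this

theorem IsPrefixEmbedding.comp {e : List α → List ℕ} (he : IsPrefixEmbedding e)
    (hh : IsPrefixEmbedding h) : IsPrefixEmbedding (e ∘ h) := fun x y =>
  (he _ _).trans (hh x y)

theorem IsStrongMap.isStrongSubtreeWith [Inhabited α] (hh : IsStrongMap h l)
    {e : List α → List ℕ} (he : IsPrefixEmbedding e) :
    IsStrongSubtreeWith (Set.range e) (Set.range (e ∘ h)) l := by
  have hf := he.comp hh.isPrefixEmbedding
  refine ⟨Set.range_comp_subset_range _ _, ?_, hh.strictMono, ?_, ?_⟩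
  · rw [UniquelyRooted, hf.level_zero]
    exact ⟨_, rfl, fun _ hs => hs⟩
  · intro n s hs
    obtain ⟨x, rfl⟩ := hs.1
    rw [Function.comp_apply, he.mem_level, hh.length, hf.mem_level.1 hs]
  · rintro _ ⟨x, rfl⟩ t ht
    obtain ⟨c, rfl⟩ := he.immSuc.1 ht
    refine ⟨(e ∘ h) (x ++ [c]), ⟨hf.immSuc.2 ⟨c, rfl⟩, (he _ _).2 (hh.append x c)⟩, ?_⟩
    rintro s' ⟨hs', hc⟩
    obtain ⟨d, rfl⟩ := hf.immSuc.1 hs'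
    rw [eq_of_append_singleton_prefix ((he _ _).1 hc) (hh.append x d)]

theorem ImmSuc.mem_level_succ {S : Set (List ℕ)} {t s : List ℕ} {n : ℕ} (hts : ImmSuc S t s)
    (ht : t ∈ level S n) : s ∈ level S (n + 1) := by
  obtain ⟨htS, hsS, hpre, hne, huniq⟩ := hts
  have hset : {u ∈ S | u <+: s ∧ u ≠ s} = insert t {u ∈ S | u <+: t ∧ u ≠ t} := by
    ext u
    simp only [Set.mem_ofPred_eq, Set.mem_insert_iff]
    constructor
    · rintro ⟨huS, hus, hne'⟩
      by_cases hut : u = t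
      · exact Or.inl hut
      · refine Or.inr ⟨huS, ?_, hut⟩
        rcases List.prefix_or_prefix_of_prefix hus hpre with h | h
        · exact h
        · rcases huniq u huS h hus with h | h
          · exact absurd h hut
          · exact absurd h hne'
    · rintro (rfl | ⟨huS, hut, hne'⟩)
      · exact ⟨htS, hpre, hne⟩
      · refine ⟨huS, hut.trans hpre, ?_⟩
        rintro rfl
        exact hne (prefix_antisymm hpre hut)
  refine ⟨hsS, ?_⟩
  rw [hset, Set.ncard_insert_of_notMem (by simp)
    ((finite_setOf_prefix t).subset fun u hu => hu.2.1), ht.2]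

theorem exists_immSuc_of_not_mem_level_zero {S : Set (List ℕ)} {s : List ℕ} (hs : s ∈ S)
    (h0 : s ∉ level S 0) : ∃ t, ImmSuc S t s := by
  have hfin : {u ∈ S | u <+: s ∧ u ≠ s}.Finite :=
    (finite_setOf_prefix s).subset fun u hu => hu.2.1
  have hne : {u ∈ S | u <+: s ∧ u ≠ s}.Nonempty := by
    rw [Set.nonempty_iff_ne_empty]
    intro h
    exact h0 ⟨hs, by rw [h, Set.ncard_empty]⟩
  obtain ⟨t, ⟨htS, hts, htne⟩, hmax⟩ := Set.exists_max_image _ List.length hfin hne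
  refine ⟨t, htS, hs, hts, htne, fun u huS htu hus => ?_⟩
  by_cases hu : u = s
  · exact Or.inr hu
  · exact Or.inl (htu.eq_of_length (le_antisymm htu.length_le (hmax u ⟨huS, hus, hu⟩))).symm

theorem IsStrongSubtreeWith.exists_isStrongMap {e : List α → List ℕ} (he : IsPrefixEmbedding e)
    {S : Set (List ℕ)} (hS : IsStrongSubtreeWith (Set.range e) S l) :
    ∃ h, IsStrongMap h l ∧ S = Set.range (e ∘ h) := by
  obtain ⟨hST, ⟨r, hr, hr'⟩, -, hlevel, hsuc⟩ := hS
  obtain ⟨x₀, rfl⟩ := hST hr.1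
  have step : ∀ x c, e x ∈ S → ∃ x', (ImmSuc S (e x) (e x') ∧ x ++ [c] <+: x') ∧
      ∀ s, ImmSuc S (e x) s → e (x ++ [c]) <+: s → s = e x' := by
    intro x c hx
    obtain ⟨s', ⟨h1, h2⟩, h3⟩ := hsuc (e x) hx _ (he.immSuc.2 ⟨c, rfl⟩)
    obtain ⟨x', rfl⟩ := hST h1.2.1
    exact ⟨x', ⟨h1, (he _ _).1 h2⟩, fun s hs hs' => h3 s ⟨hs, hs'⟩⟩
  choose! f hf hfu using step
  let h : List α → List α := fun x => x.foldl f x₀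
  have hconcat : ∀ x c, h (x ++ [c]) = f (h x) c := fun x c => by simp [h]
  have hlev : ∀ x, e (h x) ∈ level S x.length := by
    intro x
    induction x using List.reverseRecOn with
    | nil => exact hr
    | append_singleton x c ih =>
      rw [hconcat, List.length_append]
      exact (hf _ c ih.1).1.mem_level_succ ih
  have hsurj : ∀ n, ∀ s ∈ S, s.length = n → ∃ x, e (h x) = s := by
    intro n
    induction n using Nat.strong_induction_on with
    | _ n ih =>
      rintro s hs rfl
      by_cases h0 : s ∈ level S 0
      · exact ⟨[], (hr' s h0).symm⟩
      · obtain ⟨t, ht⟩ := exists_immSuc_of_not_mem_level_zero hs h0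
        obtain ⟨x, rfl⟩ := ih t.length (lt_of_le_of_ne ht.2.2.1.length_le fun hl =>
          ht.2.2.2.1 (ht.2.2.1.eq_of_length hl)) t ht.1 rfl
        obtain ⟨z, rfl⟩ := hST hs
        obtain ⟨c, hc⟩ := exists_append_singleton_prefix ((he _ _).1 ht.2.2.1)
          fun hz => ht.2.2.2.1 (hz ▸ rfl)
        exact ⟨x ++ [c], by rw [hconcat, hfu _ c ht.1 _ ht ((he _ _).2 hc)]⟩
  refine ⟨h, ⟨fun x => he.mem_level.1 (hlevel _ (hlev x)), fun x c => ?_⟩, ?_⟩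
  · rw [hconcat]
    exact (hf _ c (hlev x).1).2
  · ext s
    exact ⟨fun hs => hsurj _ s hs rfl, by rintro ⟨x, rfl⟩; exact (hlev x).1⟩

theorem IsHomogeneous.exists_isPrefixEmbedding {b : ℕ} {T : Set (List ℕ)}
    (hT : IsHomogeneous b T) :
    ∃ e : List (Fin b) → List ℕ, IsPrefixEmbedding e ∧ T = Set.range e := by
  obtain ⟨-, l, hl⟩ := hT
  rw [← range_map_val] at hl
  obtain ⟨h, hh, rfl⟩ := hl.exists_isStrongMap (isPrefixEmbedding_map_val b)
  exact ⟨_, (isPrefixEmbedding_map_val b).comp hh.isPrefixEmbedding, rfl⟩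

theorem IsPrefixEmbedding.level_fan {f : List α → List ℕ} (hf : IsPrefixEmbedding f) :
    level (level (Set.range f) 0 ∪ level (Set.range f) 1) 0 = {f []} ∧
      level (level (Set.range f) 0 ∪ level (Set.range f) 1) 1 = Set.range fun c => f [c] := by
  have hfan : level (Set.range f) 0 ∪ level (Set.range f) 1 = f '' {x | x.length ≤ 1} := by
    rw [← Set.image_univ, hf.level_image (fun _ _ _ _ => Set.mem_univ _),
      hf.level_image (fun _ _ _ _ => Set.mem_univ _), ← Set.image_union]
    congr 1
    ext x
    simp only [Set.mem_union, Set.mem_ofPred_eq, Set.mem_univ, true_and]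
    omega
  have hX : ∀ x ∈ {x : List α | x.length ≤ 1}, ∀ y, y <+: x → y ∈ {x : List α | x.length ≤ 1} :=
    fun x hx y hy => hy.length_le.trans hx
  rw [hfan, hf.level_image hX, hf.level_image hX]
  constructor
  · ext s
    constructor
    · rintro ⟨x, ⟨-, hx⟩, rfl⟩
      rw [List.length_eq_zero_iff.1 hx]
      rfl
    · rintro rfl
      exact ⟨[], ⟨by simp, rfl⟩, rfl⟩
  · ext s
    constructor
    · rintro ⟨x, ⟨-, hx⟩, rfl⟩
      obtain ⟨c, rfl⟩ := List.length_eq_one_iff.1 hx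
      exact ⟨c, rfl⟩
    · rintro ⟨c, rfl⟩
      exact ⟨[c], ⟨by simp, rfl⟩, rfl⟩

end Coding

section Fans

variable {d : ℕ} {A : Fin d → Type} {e : ∀ i, List (A i) → List ℕ}

theorem IsVecFan.exists_isOver [∀ i, Inhabited (A i)] (he : ∀ i, IsPrefixEmbedding (e i))
    {F : Fin d → Set (List ℕ)} (hF : IsVecFan (fun i => Set.range (e i)) F) :
    ∃ k n y x, k < n ∧ (∀ i, (y i).length = k) ∧ IsOver y x n ∧
      (∀ i, F i ⊆ e i '' {u | u.length ≤ n}) ∧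
      ∀ i, level (F i) 0 = {e i (y i)} ∧ level (F i) 1 = Set.range fun c => e i (x i c) := by
  obtain ⟨R, ⟨l, hl⟩, hFR⟩ := hF
  choose h hh hR using fun i => (hl i).exists_isStrongMap (he i)
  have hmono : 0 < d → StrictMono l := fun hd => (hl ⟨0, hd⟩).2.2.1
  obtain rfl | hd := d.eq_zero_or_pos
  · exact ⟨0, 1, finZeroElim, finZeroElim, one_pos, finZeroElim, finZeroElim, finZeroElim,
      finZeroElim⟩
  refine ⟨l 0, l 1, fun i => h i [], fun i c => h i [c], hmono hd one_pos,
    fun i => (hh i).length [], fun i c => ⟨(hh i).append [] c, (hh i).length [c]⟩, ?_, ?_⟩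
  · intro i s hs
    rw [hFR i] at hs
    have hRi := (hl i).2.2.2.1
    have : ∃ m ≤ 1, s ∈ level (R i) m := by
      rcases hs with hs | hs
      · exact ⟨0, zero_le_one, hs⟩
      · exact ⟨1, le_rfl, hs⟩
    obtain ⟨m, hm, hs⟩ := this
    obtain ⟨u, rfl⟩ := (hRi m hs).1
    refine ⟨u, ?_, rfl⟩
    exact ((he i).mem_level.1 (hRi m hs)).trans_le ((hmono hd).monotone hm)
  · intro i
    rw [hFR i, hR i]
    exact ((he i).comp (hh i).isPrefixEmbedding).level_fan

theorem vecLevel_one_eq {F : Fin d → Set (List ℕ)} {x : ∀ i, A i → List (A i)}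
    (hF : ∀ i, level (F i) 1 = Set.range fun c => e i (x i c)) :
    vecLevel F 1 = {r | ∀ i, ∃ c, e i (x i c) = r i} := by
  ext r
  simp [vecLevel, hF]

theorem eq_of_vecLevel_subset [∀ i, Inhabited (A i)] (he : ∀ i, IsPrefixEmbedding (e i))
    {F : Fin d → Set (List ℕ)} {x : ∀ i, A i → List (A i)}
    (hF : ∀ i, level (F i) 1 = Set.range fun c => e i (x i c)) {n : ℕ}
    (hn : vecLevel F 1 ⊆ vecLevel (fun i => Set.range (e i)) n) (i : Fin d) (c : A i) :
    (x i c).length = n := by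
  classical
  have hmem : (fun j => e j (x j (Function.update (fun _ => default) i c j))) ∈ vecLevel F 1 := by
    rw [vecLevel_one_eq hF]
    exact fun j => ⟨_, rfl⟩
  have := (he i).mem_level.1 (hn hmem i)
  simpa using this

theorem finite_fanAt [∀ i, Inhabited (A i)] [∀ i, Finite (A i)]
    (he : ∀ i, IsPrefixEmbedding (e i)) (n : ℕ) :
    (fanAt (fun i => Set.range (e i)) n).Finite := by
  have hfin : (Set.univ.pi fun i => {s | s ⊆ e i '' {u | u.length ≤ n}}).Finite :=
    Set.Finite.pi fun i => ((List.finite_length_le (A i) n).image (e i)).finite_subsets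
  refine hfin.subset fun F hF i _ => ?_
  obtain ⟨k, m, y, x, -, -, hx, hsub, hlev⟩ := hF.1.exists_isOver he
  have hm : m = n := (hx i default).2.symm.trans
    (eq_of_vecLevel_subset he (fun i => (hlev i).2) hF.2 i default)
  exact hm ▸ hsub i

/-- Insertion of `n` default letters after the first letter of a word. -/
def insertDefaults {α : Type} [Inhabited α] (n : ℕ) : List α → List α
  | [] => []
  | c :: t => c :: (List.replicate n default ++ t)

theorem isStrongMap_insertDefaults {α : Type} [Inhabited α] (n : ℕ) :
    IsStrongMap (insertDefaults (α := α) n) (fun k => if k = 0 then 0 else n + k) where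
  length x := by
    cases x with
    | nil => rfl
    | cons c t => simp [insertDefaults, add_assoc]
  append x c := by
    cases x with
    | nil => simp [insertDefaults]
    | cons d t => simp [insertDefaults]

theorem nonempty_fanAt [∀ i, Inhabited (A i)] (he : ∀ i, IsPrefixEmbedding (e i)) {n : ℕ}
    (hn : 0 < n) : (fanAt (fun i => Set.range (e i)) n).Nonempty := by
  have hR := fun i => (isStrongMap_insertDefaults (α := A i) (n - 1)).isStrongSubtreeWith (he i)
  refine ⟨_, ⟨_, ⟨_, hR⟩, fun _ => rfl⟩, fun r hr i => ?_⟩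
  have hri := hr i
  rw [((he i).comp (isStrongMap_insertDefaults _).isPrefixEmbedding).level_fan.2] at hri
  obtain ⟨c, hc⟩ := hri
  rw [← hc]
  exact (he i).mem_level.2 (by rw [(isStrongMap_insertDefaults _).length]; simp; omega)

theorem IsConcat.unique {b : ℕ} {W : Set (List ℕ)} (hW : IsHomogeneous b W) {w s s' : List ℕ}
    {p : ℕ} (hp : p < b) (hs : IsConcat W w p s) (hs' : IsConcat W w p s') : s = s' := by
  obtain ⟨-, l, hl⟩ := hW
  have hwW : w ∈ W := hs.1.1
  obtain ⟨u, rfl⟩ : w ∈ Set.range (List.map (Fin.val : Fin b → ℕ)) := by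
    rw [range_map_val]
    exact hl.1 hwW
  have hsuc : ImmSuc (bSeq b) (u.map Fin.val) (u.map Fin.val ++ [p]) := by
    rw [← range_map_val, (isPrefixEmbedding_map_val b).immSuc]
    exact ⟨⟨p, hp⟩, by simp⟩
  exact (hl.2.2.2.2 _ hwW _ hsuc).unique hs hs'

end Fans

/-- Lemma 4.8: under hypothesis (H), an "asymptotically sparse" vector
strong subtree: every node `s0` carries a direction map `φ_{s0}` controlling all fans of
`S` through `s0` sitting at levels above the level of `s0`. -/
theorem asymptotically_sparse_subtree (d : ℕ) (b : Fin d → ℕ) (T : Fin d → Set (List ℕ))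
    (hT : IsVecHomogeneous b T)
    (bW : ℕ) (W : Set (List ℕ)) (hW : IsHomogeneous bW W)
    (ε : ℝ) (hε0 : 0 < ε) (hε1 : ε ≤ 1)
    (l : ℕ → ℕ) (D : (Fin d → List ℕ) → Set (List ℕ)) (hD : IsDenseLevelSel T W l ε D)
    (hH : ∀ (R : Fin d → Set (List ℕ)) (r0 : Fin d → List ℕ) (w : List ℕ) (θ : ℝ),
      IsVecStrongSubtree T R → IsRoot R r0 → w ∈ W → 0 < θ → θ ≤ 1 →
        ¬ StronglyCorrelated T W bW l D R r0 w θ) :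
    ∃ S : Fin d → Set (List ℕ), IsVecStrongSubtree T S ∧
      ∀ s0 ∈ levelProd S, ∃ φ : List ℕ → ℕ, (∀ w ∈ D s0, φ w < bW) ∧
        ∀ k, s0 ∈ vecLevel S k → ∀ n, k < n →
          ∀ F ∈ fanAt S n, IsRoot F s0 →
            ∀ w ∈ D s0, ∀ m, vecLevel F 1 ⊆ vecLevel T m →
              ∀ s, IsConcat W w (φ w) s →
                densRel W (l m) (⋂ t ∈ vecLevel F 1, D t) s
                  ≤ ε / (2 * (bW : ℝ) * ((fanAt T n).ncard : ℝ)) := by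
  classical
  have hne : ∀ n, ∀ v ∈ vecLevel T n, (D v).ncard ≠ 0 := fun n v hv h0 => by
    have := (hD.2 n v hv).2
    rw [dens, h0, Nat.cast_zero, zero_div] at this
    exact absurd hε0 this.not_gt
  obtain rfl | hd := d.eq_zero_or_pos
  · have h0 := (hD.2 0 finZeroElim finZeroElim).1
    have h1 := (hD.2 1 finZeroElim finZeroElim).1
    obtain ⟨w, hw⟩ := Set.nonempty_of_ncard_ne_zero (hne 0 finZeroElim finZeroElim)
    exact absurd ((h0 hw).2.symm.trans (h1 hw).2) (hD.1 zero_lt_one).ne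
  have : ∀ i, NeZero (b i) := fun i => ⟨by have := (hT i).1; omega⟩
  have : Nonempty (Fin d) := ⟨⟨0, hd⟩⟩
  let i₀ : Fin d := ⟨0, hd⟩
  choose e he hTe using fun i => (hT i).exists_isPrefixEmbedding
  obtain rfl : T = fun i => Set.range (e i) := funext hTe
  have hmem : ∀ (s : ∀ i, List (Fin (b i))) m, (∀ i, (s i).length = m) →
      (fun i => e i (s i)) ∈ vecLevel (fun i => Set.range (e i)) m := fun s m hs i =>
    (he i).mem_level.2 (hs i)
  let g : (∀ i, List (Fin (b i))) → List ℕ → ℕ → (∀ i, Fin (b i) → List (Fin (b i))) → ℝ :=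
    fun _ w p t => if h : ∃ s, IsConcat W w p s then
      densRel W (l (t i₀ default).length) (⋂ r ∈ {r | ∀ i, ∃ c, e i (t i c) = r i}, D r) h.choose
    else 0
  have hgval : ∀ (F : Fin d → Set (List ℕ)) (x : ∀ i, Fin (b i) → List (Fin (b i))),
      (∀ i, level (F i) 1 = Set.range fun c => e i (x i c)) → ∀ n,
      vecLevel F 1 ⊆ vecLevel (fun i => Set.range (e i)) n → ∀ s₀ w, ∀ p < bW, ∀ s,
      IsConcat W w p s → g s₀ w p x = densRel W (l n) (⋂ r ∈ vecLevel F 1, D r) s := by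
    intro F x hF n hn s₀ w p hp s hs
    have hex : ∃ s, IsConcat W w p s := ⟨s, hs⟩
    rw [vecLevel_one_eq hF, ← eq_of_vecLevel_subset he hF hn i₀ default,
      hs.unique hW hp hex.choose_spec]
    exact dif_pos hex
  obtain ⟨r, l', hr, hfan⟩ := exists_sparse_strongMap (N := bW)
    (fun s : ∀ i, List (Fin (b i)) => D fun i => e i (s i)) g
    (fun s ⟨m, hs⟩ => Set.finite_of_ncard_ne_zero (hne m _ (hmem s m hs)))
    (by
      rintro s ⟨m, hs⟩ w hw θ hθ r l' hr hrs
      have hre := fun i => (he i).comp (hr i).isPrefixEmbedding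
      have hR := fun i => (hr i).isStrongSubtreeWith (he i)
      have hnot := hH (fun i => Set.range (e i ∘ r i)) (fun i => e i (s i)) w (min θ 1) ⟨l', hR⟩
        (fun i => by rw [(hre i).level_zero, Function.comp_apply, hrs])
        ((hD.2 m _ (hmem s m hs)).1 hw).1 (lt_min hθ one_pos) (min_le_right _ _)
      simp only [StronglyCorrelated, not_and, not_forall, not_le] at hnot
      obtain ⟨F, hF, hroot, n, hn, p, hp, s', hs', hlt⟩ := hnot hw
      obtain ⟨k, m', y, x, hk, -, hx, -, hlev⟩ := hF.exists_isOver hre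
      have hy : y = fun _ => [] := funext fun i => (hre i).injective (by
        have := (hlev i).1.symm.trans (hroot i)
        rw [Function.comp_apply, Function.comp_apply, hrs]
        exact Set.singleton_injective this)
      subst hy
      refine ⟨x, m', by omega, hx, p, hp, ?_⟩
      rw [hgval F (fun i c => r i (x i c)) (fun i => (hlev i).2) n hn s w p hp s' hs']
      exact hlt.le.trans (min_le_left _ _))
    (θ := fun n => ε / (2 * (bW : ℝ) * ((fanAt (fun i => Set.range (e i)) n).ncard : ℝ)))
    (fun n hn => by
      have h1 : 0 < bW := by have := hW.1; omega
      have h2 : 0 < (fanAt (fun i => Set.range (e i)) n).ncard :=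
        (Set.ncard_pos (finite_fanAt he n)).2 (nonempty_fanAt he hn)
      positivity)
  have hre := fun i => (he i).comp (hr i).isPrefixEmbedding
  refine ⟨fun i => Set.range (e i ∘ r i), ⟨l', fun i => (hr i).isStrongSubtreeWith (he i)⟩, ?_⟩
  intro s0 hs0
  obtain ⟨k, hk⟩ := Set.mem_iUnion.1 hs0
  choose y hy using fun i => (hk i).1
  obtain rfl : (fun i => (e i ∘ r i) (y i)) = s0 := funext hy
  have hyk : ∀ k', (fun i => (e i ∘ r i) (y i)) ∈ vecLevel (fun i => Set.range (e i ∘ r i)) k' →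
      ∀ i, (y i).length = k' := fun k' hk' i => (hre i).mem_level.1 (hk' i)
  have hsel := hfan k y (hyk k hk)
  choose! φ hφ hsel using hsel
  refine ⟨φ, hφ, ?_⟩
  intro k' hk' n hn F hF hroot w hw m hm s hs
  obtain rfl : k' = k := (hyk k' hk' i₀).symm.trans (hyk k hk i₀)
  obtain ⟨-, n', y', x, -, -, hx, -, hlev⟩ := hF.1.exists_isOver hre
  obtain rfl : y' = y := funext fun i => (hre i).injective
    (Set.singleton_injective ((hlev i).1.symm.trans (hroot i)))
  obtain rfl : n' = n := (hx i₀ default).2.symm.trans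
    (eq_of_vecLevel_subset hre (fun i => (hlev i).2) hF.2 i₀ default)
  rw [← hgval F (fun i c => r i (x i c)) (fun i => (hlev i).2) m hm (fun i => r i (y' i)) w (φ w)
    (hφ w hw) s hs]
  exact hsel w hw n' hn x hx
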